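/- Let Ξ and M be real symmetric positive definite n×n matrices. Then every eigenvalue μ of the matrix (Ξ + M)⁻¹ Ξ is real and satisfies 0 < μ ≤ λ_max(Ξ)/(λ_max(Ξ) + λ_min(M)) < 1, where λ_max(Ξ) is the largest eigenvalue of Ξ and λ_min(M) the smallest eigenvalue of M. In particular all eigenvalues of (Ξ + M)⁻¹Ξ lie in (0,1). -/

import Mathlib

open Matrix

/-- A lower bound on the spectrum of a real symmetric matrix bounds its quadratic form below. -/
lemma Matrix.IsHermitian.le_quadraticForm {n : Type*} [Fintype n] [DecidableEq n]
    {A : Matrix n n ℝ} (hA : A.IsHermitian) {c : ℝ} (hc : ∀ i, c ≤ hA.eigenvalues i) (x : n → ℝ) :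
    c * (x ⬝ᵥ x) ≤ x ⬝ᵥ (A *ᵥ x) := by
  have hB : (A - algebraMap ℝ _ c).IsHermitian :=
    hA.sub (by simp [IsHermitian, algebraMap_eq_diagonal])
  have hpsd : (A - algebraMap ℝ _ c).PosSemidef := by
    rw [hB.posSemidef_iff_eigenvalues_nonneg]
    intro i
    have h := hB.eigenvalues_mem_spectrum_real i
    rw [← spectrum.sub_singleton_eq, hA.spectrum_real_eq_range_eigenvalues] at h
    obtain ⟨_, ⟨j, rfl⟩, _, rfl, h⟩ := h
    have := hc j
    simp only [Pi.zero_apply]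
    rw [← h]
    simpa using this
  have := hpsd.dotProduct_mulVec_nonneg x
  simp only [star_trivial, sub_mulVec, dotProduct_sub, Algebra.algebraMap_eq_smul_one,
    smul_mulVec, one_mulVec, dotProduct_smul, smul_eq_mul] at this
  linarith

/-- An upper bound on the spectrum of a real symmetric matrix bounds its quadratic form above. -/
lemma Matrix.IsHermitian.quadraticForm_le {n : Type*} [Fintype n] [DecidableEq n]
    {A : Matrix n n ℝ} (hA : A.IsHermitian) {c : ℝ} (hc : ∀ i, hA.eigenvalues i ≤ c) (x : n → ℝ) :
    x ⬝ᵥ (A *ᵥ x) ≤ c * (x ⬝ᵥ x) := by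
  have hB : (algebraMap ℝ _ c - A).IsHermitian :=
    IsHermitian.sub (by simp [IsHermitian, algebraMap_eq_diagonal]) hA
  have hpsd : (algebraMap ℝ _ c - A).PosSemidef := by
    rw [hB.posSemidef_iff_eigenvalues_nonneg]
    intro i
    have h := hB.eigenvalues_mem_spectrum_real i
    rw [← spectrum.singleton_sub_eq, hA.spectrum_real_eq_range_eigenvalues] at h
    obtain ⟨_, rfl, _, ⟨j, rfl⟩, h⟩ := h
    have := hc j
    simp only [Pi.zero_apply]
    rw [← h]
    simpa using this
  have := hpsd.dotProduct_mulVec_nonneg x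
  simp only [star_trivial, sub_mulVec, dotProduct_sub, Algebra.algebraMap_eq_smul_one,
    smul_mulVec, one_mulVec, dotProduct_smul, smul_eq_mul] at this
  linarith

/-- A complex eigenvector of a real matrix, split into its real and imaginary parts. -/
lemma Matrix.exists_re_im_of_mem_spectrum_map_ofReal {n : Type*} [Fintype n] [DecidableEq n]
    {B : Matrix n n ℝ} {μ : ℂ} (hμ : μ ∈ spectrum ℂ (B.map Complex.ofReal)) :
    ∃ x y : n → ℝ, (x ≠ 0 ∨ y ≠ 0) ∧
      B *ᵥ x = μ.re • x - μ.im • y ∧ B *ᵥ y = μ.re • y + μ.im • x := by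
  rw [← Matrix.spectrum_toLin', ← Module.End.hasEigenvalue_iff_mem_spectrum] at hμ
  obtain ⟨v, hv⟩ := hμ.exists_hasEigenvector
  have h := hv.apply_eq_smul
  rw [toLin'_apply] at h
  refine ⟨fun i => (v i).re, fun i => (v i).im, ?_, ?_, ?_⟩
  · by_contra! h0
    exact hv.2 (funext fun i => Complex.ext (congrFun h0.1 i) (congrFun h0.2 i))
  · ext i
    simpa [mulVec, dotProduct] using congrArg Complex.re (congrFun h i)
  · ext i
    simpa [mulVec, dotProduct, Complex.mul_im] using congrArg Complex.im (congrFun h i)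

lemma Matrix.IsHermitian.dotProduct_mulVec_comm_real {n : Type*} [Fintype n]
    {A : Matrix n n ℝ} (hA : A.IsHermitian) (x y : n → ℝ) :
    x ⬝ᵥ (A *ᵥ y) = y ⬝ᵥ (A *ᵥ x) := by
  have hT : Aᵀ = A := by simpa [IsHermitian] using hA
  rw [dotProduct_mulVec, ← mulVec_transpose, hT, dotProduct_comm]

/-- Stability of the RHMC update matrix: for symmetric positive
definite `Ξ` and `M`, every eigenvalue `μ` of `(Ξ + M)⁻¹ Ξ` is real and satisfies
`0 < μ ≤ λ_max(Ξ)/(λ_max(Ξ) + λ_min(M)) < 1`. -/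
theorem rhmc_update_matrix_eigenvalues {n : ℕ} (hn : 0 < n)
    (Ξ M : Matrix (Fin n) (Fin n) ℝ) (hΞ : Ξ.PosDef) (hM : M.PosDef) :
    (⨆ i, hΞ.1.eigenvalues i) / ((⨆ i, hΞ.1.eigenvalues i) + ⨅ i, hM.1.eigenvalues i) < 1
      ∧ ∀ μ ∈ spectrum ℂ (((Ξ + M)⁻¹ * Ξ).map Complex.ofReal),
        μ.im = 0 ∧ 0 < μ.re
          ∧ μ.re ≤ (⨆ i, hΞ.1.eigenvalues i)
              / ((⨆ i, hΞ.1.eigenvalues i) + ⨅ i, hM.1.eigenvalues i) := by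
  have : Nonempty (Fin n) := ⟨⟨0, hn⟩⟩
  have hΞle : ∀ i, hΞ.1.eigenvalues i ≤ ⨆ i, hΞ.1.eigenvalues i :=
    le_ciSup (Set.finite_range _).bddAbove
  have hMle : ∀ i, ⨅ i, hM.1.eigenvalues i ≤ hM.1.eigenvalues i :=
    ciInf_le (Set.finite_range _).bddBelow
  have hL : 0 < ⨆ i, hΞ.1.eigenvalues i := (hΞ.eigenvalues_pos ⟨0, hn⟩).trans_le (hΞle _)
  have hl : 0 < ⨅ i, hM.1.eigenvalues i := by
    obtain ⟨i, hi⟩ := exists_eq_ciInf_of_finite (f := hM.1.eigenvalues)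
    exact hi ▸ hM.eigenvalues_pos i
  have hΞq := hΞ.1.quadraticForm_le hΞle
  have hMq := hM.1.le_quadraticForm hMle
  generalize (⨆ i, hΞ.1.eigenvalues i) = L at *
  generalize (⨅ i, hM.1.eigenvalues i) = l at *
  refine ⟨by rw [div_lt_one (by positivity)]; linarith, fun μ hμ => ?_⟩
  obtain ⟨x, y, hxy, hx, hy⟩ := exists_re_im_of_mem_spectrum_map_ofReal hμ
  have hdet : IsUnit (Ξ + M).det := (isUnit_iff_isUnit_det _).1 (hΞ.add hM).isUnit
  have hSB : (Ξ + M) * ((Ξ + M)⁻¹ * Ξ) = Ξ := mul_nonsing_inv_cancel_left _ _ hdet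
  have hx' := congrArg ((Ξ + M) *ᵥ ·) hx
  have hy' := congrArg ((Ξ + M) *ᵥ ·) hy
  simp only [mulVec_mulVec, hSB, mulVec_sub, mulVec_add, mulVec_smul, add_mulVec] at hx' hy'
  have hxx := congrArg (x ⬝ᵥ ·) hx'
  have hyx := congrArg (y ⬝ᵥ ·) hx'
  have hxy' := congrArg (x ⬝ᵥ ·) hy'
  have hyy := congrArg (y ⬝ᵥ ·) hy'
  simp only [dotProduct_sub, dotProduct_add, dotProduct_smul, smul_eq_mul] at hxx hyx hxy' hyy
  rw [hΞ.1.dotProduct_mulVec_comm_real y x, hM.1.dotProduct_mulVec_comm_real y x] at hyx hyy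
  have nonneg {A : Matrix (Fin n) (Fin n) ℝ} (hA : A.PosDef) (z : Fin n → ℝ) :
      0 ≤ z ⬝ᵥ (A *ᵥ z) := by
    simpa using hA.posSemidef.dotProduct_mulVec_nonneg z
  have pos {A : Matrix (Fin n) (Fin n) ℝ} (hA : A.PosDef) :
      0 < x ⬝ᵥ (A *ᵥ x) + y ⬝ᵥ (A *ᵥ y) := by
    rcases hxy with h | h
    · exact add_pos_of_pos_of_nonneg (by simpa using hA.dotProduct_mulVec_pos h) (nonneg hA y)
    · exact add_pos_of_nonneg_of_pos (nonneg hA x) (by simpa using hA.dotProduct_mulVec_pos h)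
  have ha := pos hΞ
  have hb := pos hM
  have ha_le : x ⬝ᵥ (Ξ *ᵥ x) + y ⬝ᵥ (Ξ *ᵥ y) ≤ L * (x ⬝ᵥ x + y ⬝ᵥ y) := by
    linarith [hΞq x, hΞq y]
  have hb_le : l * (x ⬝ᵥ x + y ⬝ᵥ y) ≤ x ⬝ᵥ (M *ᵥ x) + y ⬝ᵥ (M *ᵥ y) := by
    linarith [hMq x, hMq y]
  have hre : x ⬝ᵥ (Ξ *ᵥ x) + y ⬝ᵥ (Ξ *ᵥ y) = μ.re *
      ((x ⬝ᵥ (Ξ *ᵥ x) + y ⬝ᵥ (Ξ *ᵥ y)) + (x ⬝ᵥ (M *ᵥ x) + y ⬝ᵥ (M *ᵥ y))) := by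
    linear_combination hxx + hyy
  have him : μ.im *
      ((x ⬝ᵥ (Ξ *ᵥ x) + y ⬝ᵥ (Ξ *ᵥ y)) + (x ⬝ᵥ (M *ᵥ x) + y ⬝ᵥ (M *ᵥ y))) = 0 := by
    linear_combination hyx - hxy'
  generalize x ⬝ᵥ (Ξ *ᵥ x) + y ⬝ᵥ (Ξ *ᵥ y) = a at *
  generalize x ⬝ᵥ (M *ᵥ x) + y ⬝ᵥ (M *ᵥ y) = b at *
  have hre' : μ.re = a / (a + b) := by
    rw [eq_div_iff (by positivity)]
    exact hre.symm
  refine ⟨(mul_eq_zero.1 him).resolve_right (by positivity), hre' ▸ by positivity, ?_⟩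
  rw [hre', div_le_div_iff₀ (by positivity) (by positivity)]
  linarith [mul_le_mul_of_nonneg_left ha_le hl.le, mul_le_mul_of_nonneg_left hb_le hL.le]
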